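/- Every 2-extendable non-bipartite finite simple graph on 10 vertices has at least 19 edges, and there exists a 2-extendable non-bipartite finite simple graph on 10 vertices with exactly 19 edges; hence ε(10,2) = 19. -/

import Mathlib

open SimpleGraph

/-- `G` is `n`-factor-critical if for every set `S` of exactly `n` vertices,
the graph obtained by deleting `S` has a perfect matching; formalized as:
there is a matching of `G` whose vertex set is exactly the complement of `S`. -/
def IsFactorCritical {V : Type*} (G : SimpleGraph V) (n : ℕ) : Prop :=
  ∀ S : Finset V, S.card = n →
    ∃ M : G.Subgraph, M.IsMatching ∧ M.verts = (↑S : Set V)ᶜ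

/-- `G` is `k`-extendable if it is connected, has a matching with `k` edges,
and every matching with `k` edges is contained in a perfect matching. -/
def IsExtendable {V : Type*} (G : SimpleGraph V) (k : ℕ) : Prop :=
  G.Connected ∧
  (∃ M : G.Subgraph, M.IsMatching ∧ M.edgeSet.ncard = k) ∧
  ∀ M : G.Subgraph, M.IsMatching → M.edgeSet.ncard = k →
    ∃ P : G.Subgraph, P.IsPerfectMatching ∧ M ≤ P

/-- A subgraph given by an involution along edges is a perfect matching. -/
lemma exists_isPerfectMatching_of_involutive {V : Type*} {G : SimpleGraph V} {f : V → V}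
    (hf : Function.Involutive f) (hadj : ∀ v, G.Adj v (f v)) :
    ∃ P : G.Subgraph, P.IsPerfectMatching ∧ ∀ v w, P.Adj v w ↔ f v = w := by
  refine ⟨⟨Set.univ, fun v w => f v = w, ?_, ?_, ?_⟩, ?_, fun _ _ => Iff.rfl⟩
  · rintro v w rfl
    exact hadj v
  · intros
    trivial
  · refine ⟨?_⟩
    rintro v w rfl
    exact hf v
  · rw [Subgraph.isPerfectMatching_iff]
    intro v
    exact ⟨f v, rfl, fun w hw => Eq.symm hw⟩

lemma exists_injective_of_isPerfectMatching {V : Type*} {G : SimpleGraph V} {P : G.Subgraph}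
    (hP : P.IsPerfectMatching) :
    ∃ f : V → V, Function.Injective f ∧ (∀ v, G.Adj v (f v)) ∧ ∀ v w, P.Adj v w → f v = w := by
  choose f hf hf' using Subgraph.isPerfectMatching_iff.1 hP
  refine ⟨f, fun v w hvw => ?_, fun v => (hf v).adj_sub, fun v w h => (hf' v w h).symm⟩
  have h1 := hf v
  rw [hvw] at h1
  exact hP.1.eq_of_adj_right h1 (hf w)

lemma IsExtendable.exists_matching_map {V : Type*} {G : SimpleGraph V} (hG : IsExtendable G 2)
    {a b c d : V} (hab : G.Adj a b) (hcd : G.Adj c d)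
    (hac : a ≠ c) (had : a ≠ d) (hbc : b ≠ c) (hbd : b ≠ d) :
    ∃ f : V → V, Function.Injective f ∧ (∀ v, G.Adj v (f v)) ∧
      f a = b ∧ f b = a ∧ f c = d ∧ f d = c := by
  have hM : (G.subgraphOfAdj hab ⊔ G.subgraphOfAdj hcd).IsMatching := by
    refine (Subgraph.IsMatching.subgraphOfAdj hab).sup (Subgraph.IsMatching.subgraphOfAdj hcd) ?_
    rw [support_subgraphOfAdj, support_subgraphOfAdj, Set.disjoint_left]
    simp only [Set.mem_insert_iff, Set.mem_singleton_iff]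
    grind
  obtain ⟨P, hP, hle⟩ := hG.2.2 _ hM (by
    rw [Subgraph.edgeSet_sup, edgeSet_subgraphOfAdj, edgeSet_subgraphOfAdj, Set.singleton_union,
      Set.ncard_pair]
    simp only [ne_eq, Sym2.eq_iff]
    grind)
  obtain ⟨f, hf, hadj, hfP⟩ := exists_injective_of_isPerfectMatching hP
  refine ⟨f, hf, hadj, ?_, ?_, ?_, ?_⟩ <;> refine hfP _ _ (hle.2 ?_) <;> simp

lemma IsExtendable.exists_matching_map_of_adj {V : Type*} [Fintype V] {G : SimpleGraph V}
    (hG : IsExtendable G 2) (hV : Fintype.card V = 10) {a b : V} (hab : G.Adj a b) :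
    ∃ f : V → V, Function.Injective f ∧ (∀ v, G.Adj v (f v)) ∧ f a = b ∧ f b = a := by
  classical
  obtain ⟨M, hM, hM2⟩ := hG.2.1
  obtain ⟨P, hP, -⟩ := hG.2.2 M hM hM2
  obtain ⟨f, hf, hadj, hfP⟩ := exists_injective_of_isPerfectMatching hP
  obtain ⟨c, hc⟩ : ∃ c, c ∉ ({a, b, f a, f b} : Finset V) := by
    by_contra! h
    have := Finset.card_le_card (fun c _ => h c : (Finset.univ : Finset V) ⊆ _)
    have := Finset.card_le_four (a := a) (b := b) (c := f a) (d := f b)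
    rw [Finset.card_univ] at *
    omega
  simp only [Finset.mem_insert, Finset.mem_singleton, not_or] at hc
  have hinv : f (f c) = c := hfP _ _ (by
    obtain ⟨w, hw, -⟩ := Subgraph.isPerfectMatching_iff.1 hP c
    rw [hfP _ _ hw]
    exact hw.symm)
  obtain ⟨g, hg, hgadj, h1, h2, -⟩ := hG.exists_matching_map hab (hadj c) (Ne.symm hc.1)
    (fun h => hc.2.2.1 (by rw [h, hinv])) (Ne.symm hc.2.1) (fun h => hc.2.2.2 (by rw [h, hinv]))
  exact ⟨g, hg, hgadj, h1, h2⟩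

/-- The edges of a 2-extendable non-bipartite graph on ten vertices. -/
def sparseEdges : Finset (Sym2 (Fin 10)) :=
  {s(0, 1), s(0, 2), s(0, 6), s(0, 7), s(1, 5), s(1, 7), s(1, 9), s(2, 3), s(2, 4), s(2, 5),
    s(3, 4), s(3, 5), s(3, 7), s(4, 6), s(4, 9), s(5, 8), s(6, 7), s(6, 8), s(8, 9)}

/-- A 2-extendable non-bipartite graph on ten vertices with 19 edges. -/
def sparseGraph : SimpleGraph (Fin 10) := fromEdgeSet (sparseEdges : Set (Sym2 (Fin 10)))

instance : DecidableRel sparseGraph.Adj := fun v w =>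
  decidable_of_iff (s(v, w) ∈ sparseEdges ∧ v ≠ w) (by simp [sparseGraph])

/-- Perfect matchings of `sparseGraph`, each given by the map swapping matched vertices. -/
def sparseMatchings : Fin 21 → Fin 10 → Fin 10 :=
  ![![1,0,3,2,9,8,7,6,5,4], ![1,0,5,7,6,2,4,3,9,8], ![2,5,0,4,3,1,7,6,9,8],
    ![2,7,0,5,9,3,8,1,6,4], ![6,9,4,7,2,8,0,3,5,1], ![7,9,5,4,3,2,8,0,6,1],
    ![6,7,4,5,2,3,0,1,9,8], ![7,5,3,2,6,1,4,0,9,8], ![2,5,0,7,9,1,8,3,6,4],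
    ![2,9,0,7,6,8,4,3,5,1], ![1,0,4,5,2,3,7,6,9,8], ![6,7,3,2,9,8,0,1,5,4],
    ![6,7,5,4,3,2,0,1,9,8], ![7,9,4,5,2,3,8,0,6,1], ![1,0,5,4,3,2,7,6,9,8],
    ![1,0,5,7,9,2,8,3,6,4], ![2,7,0,5,6,3,4,1,9,8], ![2,9,0,4,3,8,7,6,5,1],
    ![6,5,4,7,2,1,0,3,9,8], ![7,5,3,2,9,1,8,0,6,4], ![7,9,3,2,6,8,4,0,5,1]]

lemma sparseMatchings_valid :
    ∀ i v, sparseMatchings i (sparseMatchings i v) = v ∧ sparseGraph.Adj v (sparseMatchings i v) := by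
  decide +kernel

lemma sparseMatchings_cover : ∀ a b, sparseGraph.Adj a b → ∀ c d, sparseGraph.Adj c d →
    a ≠ c ∧ a ≠ d ∧ b ≠ c ∧ b ≠ d →
    ∃ i, sparseMatchings i a = b ∧ sparseMatchings i c = d := by
  decide +kernel

lemma sparseGraph_connected : sparseGraph.Connected := by
  have h : ∀ {v w}, sparseGraph.Adj v w → sparseGraph.Reachable v w := fun h => h.reachable
  have h0 : ∀ v, sparseGraph.Reachable 0 v := by
    have h1 : sparseGraph.Reachable 0 1 := h (by decide)
    have h2 : sparseGraph.Reachable 0 2 := h (by decide)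
    have h6 : sparseGraph.Reachable 0 6 := h (by decide)
    have h7 : sparseGraph.Reachable 0 7 := h (by decide)
    have h5 : sparseGraph.Reachable 0 5 := h1.trans (h (by decide))
    have h9 : sparseGraph.Reachable 0 9 := h1.trans (h (by decide))
    have h3 : sparseGraph.Reachable 0 3 := h2.trans (h (by decide))
    have h4 : sparseGraph.Reachable 0 4 := h2.trans (h (by decide))
    have h8 : sparseGraph.Reachable 0 8 := h6.trans (h (by decide))
    intro v
    fin_cases v
    exacts [Reachable.rfl, h1, h2, h3, h4, h5, h6, h7, h8, h9]
  exact ⟨fun v w => (h0 v).symm.trans (h0 w)⟩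

lemma exists_two_adj_of_isMatching {V : Type*} {G : SimpleGraph V} {M : G.Subgraph}
    (hM : M.IsMatching) (h2 : M.edgeSet.ncard = 2) :
    ∃ a b c d, M.edgeSet = {s(a, b), s(c, d)} ∧ M.Adj a b ∧ M.Adj c d ∧
      a ≠ c ∧ a ≠ d ∧ b ≠ c ∧ b ≠ d := by
  obtain ⟨e, e', hne, he⟩ := Set.ncard_eq_two.1 h2
  induction e with | _ a b
  induction e' with | _ c d
  have hab : M.Adj a b := by
    rw [← Subgraph.mem_edgeSet, he]
    simp
  have hcd : M.Adj c d := by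
    rw [← Subgraph.mem_edgeSet, he]
    simp
  refine ⟨a, b, c, d, he, hab, hcd, ?_, ?_, ?_, ?_⟩ <;> rintro rfl <;> apply hne
  · rw [hM.eq_of_adj_left hab hcd]
  · rw [hM.eq_of_adj_left hab hcd.symm, Sym2.eq_swap]
  · rw [hM.eq_of_adj_left hab.symm hcd, Sym2.eq_swap]
  · rw [hM.eq_of_adj_right hab hcd]

lemma sparseGraph_isExtendable : IsExtendable sparseGraph 2 := by
  have key : ∀ M : sparseGraph.Subgraph, M.IsMatching → M.edgeSet.ncard = 2 →
      ∃ P : sparseGraph.Subgraph, P.IsPerfectMatching ∧ M ≤ P := by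
    intro M hM h2
    obtain ⟨a, b, c, d, he, hab, hcd, h⟩ := exists_two_adj_of_isMatching hM h2
    obtain ⟨i, hfa, hfc⟩ := sparseMatchings_cover a b hab.adj_sub c d hcd.adj_sub h
    have hv := sparseMatchings_valid i
    obtain ⟨P, hP, hPf⟩ :=
      exists_isPerfectMatching_of_involutive (fun v => (hv v).1) (fun v => (hv v).2)
    refine ⟨P, hP, fun v _ => hP.2 v, fun v w hvw => ?_⟩
    rw [← Subgraph.mem_edgeSet, he] at hvw
    simp only [Set.mem_insert_iff, Set.mem_singleton_iff, Sym2.eq_iff] at hvw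
    rw [hPf]
    rcases hvw with (⟨rfl, rfl⟩ | ⟨rfl, rfl⟩) | (⟨rfl, rfl⟩ | ⟨rfl, rfl⟩)
    · exact hfa
    · rw [← hfa, (hv _).1]
    · exact hfc
    · rw [← hfc, (hv _).1]
  refine ⟨sparseGraph_connected, ?_, key⟩
  have h01 : sparseGraph.Adj 0 1 := by decide
  have h23 : sparseGraph.Adj 2 3 := by decide
  refine ⟨sparseGraph.subgraphOfAdj h01 ⊔ sparseGraph.subgraphOfAdj h23, ?_, ?_⟩
  · refine (Subgraph.IsMatching.subgraphOfAdj h01).sup (Subgraph.IsMatching.subgraphOfAdj h23) ?_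
    rw [support_subgraphOfAdj, support_subgraphOfAdj, Set.disjoint_left]
    simp
  · rw [Subgraph.edgeSet_sup, edgeSet_subgraphOfAdj, edgeSet_subgraphOfAdj, Set.singleton_union,
      Set.ncard_pair (by decide)]

lemma sparseGraph_not_colorable : ¬ sparseGraph.Colorable 2 := by
  rintro ⟨C⟩
  have h1 : C 2 ≠ C 3 := C.valid (by decide)
  have h2 : C 2 ≠ C 4 := C.valid (by decide)
  have h3 : C 3 ≠ C 4 := C.valid (by decide)
  omega

lemma sparseGraph_ncard_edgeSet : sparseGraph.edgeSet.ncard = 19 := by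
  have h : sparseGraph.edgeSet = (sparseEdges : Set (Sym2 (Fin 10))) := by
    rw [sparseGraph, edgeSet_fromEdgeSet, sdiff_eq_left, Set.disjoint_left]
    intro e he
    revert e
    simp only [Finset.mem_coe, Sym2.mem_diagSet]
    decide
  rw [h, Set.ncard_coe_finset]
  decide

lemma SimpleGraph.Connected.mem_of_adj_closed {V : Type*} {G : SimpleGraph V} (hG : G.Connected)
    {s : Set V} (hs : s.Nonempty) (hcl : ∀ v ∈ s, ∀ w, G.Adj v w → w ∈ s) (v : V) : v ∈ s := by
  obtain ⟨x, hx⟩ := hs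
  obtain ⟨p⟩ := hG x v
  induction p with
  | nil => exact hx
  | cons h _ ih => exact ih (hcl _ hx _ h)

lemma SimpleGraph.Connected.exists_adj_notMem {V : Type*} [Fintype V] {G : SimpleGraph V}
    (hG : G.Connected) {s : Finset V} (hs : s.Nonempty) (hcard : s.card < Fintype.card V) :
    ∃ v ∈ s, ∃ w, G.Adj v w ∧ w ∉ s := by
  by_contra! h
  have hall := hG.mem_of_adj_closed (s := (s : Set V)) hs h
  have := Finset.card_le_card (fun v _ => hall v : Finset.univ ⊆ s)
  rw [Finset.card_univ] at this
  omega

section Extendable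

variable {V : Type*} [Fintype V] {G : SimpleGraph V}

lemma IsExtendable.exists_second_neighbor (hG : IsExtendable G 2) (hV : Fintype.card V = 10)
    {u a : V} (hua : G.Adj u a) : ∃ b, b ≠ a ∧ G.Adj u b := by
  classical
  by_contra! h
  have hu : ∀ x, G.Adj u x → x = a := fun x hx => by_contra fun hne => h x hne hx
  obtain ⟨v, hv, x, hvx, hx⟩ := hG.1.exists_adj_notMem (s := {u, a}) (by simp)
    (by have := Finset.card_le_two (a := u) (b := a); omega)
  simp only [Finset.mem_insert, Finset.mem_singleton, not_or] at hv hx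
  have hax : G.Adj a x := by
    rcases hv with rfl | rfl
    · exact absurd (hu x hvx) hx.2
    · exact hvx
  obtain ⟨f, hf, hadj, hfa, hfx⟩ := hG.exists_matching_map_of_adj hV hax
  exact hx.1 (hf (hfx.trans (hu _ (hadj u)).symm))

lemma IsExtendable.three_le_degree [DecidableRel G.Adj] (hG : IsExtendable G 2)
    (hV : Fintype.card V = 10) (u : V) : 3 ≤ G.degree u := by
  classical
  by_contra! hdeg
  obtain ⟨u', hu', a, hua, -⟩ := hG.1.exists_adj_notMem (s := {u}) (by simp) (by simp; omega)
  rw [Finset.mem_singleton] at hu'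
  subst hu'
  obtain ⟨b, hba, hub⟩ := hG.exists_second_neighbor hV hua
  have hu : ∀ x, G.Adj u' x → x = a ∨ x = b := by
    intro x hx
    have hsub : ({a, b} : Finset V) ⊆ G.neighborFinset u' := by
      intro y hy
      simp only [Finset.mem_insert, Finset.mem_singleton] at hy
      rw [mem_neighborFinset]
      rcases hy with rfl | rfl <;> assumption
    have heq := Finset.eq_of_subset_of_card_le hsub (by
      rw [Finset.card_pair hba.symm, card_neighborFinset_eq_degree]
      omega)
    rw [← mem_neighborFinset, ← heq] at hx
    simpa using hx
  have hab : ¬ G.Adj a b := by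
    intro hab
    obtain ⟨f, hf, hadj, hfa, hfb⟩ := hG.exists_matching_map_of_adj hV hab
    rcases hu _ (hadj u') with h | h
    · exact hub.ne (hf (h.trans hfb.symm))
    · exact hua.ne (hf (h.trans hfa.symm))
  have huniq : ∀ x y, G.Adj a x → G.Adj b y → x ≠ u' → y ≠ u' → x = y := by
    intro x y hax hby hxu hyu
    by_contra hxy
    obtain ⟨f, hf, hadj, h1, h2, h3, h4⟩ := hG.exists_matching_map hax hby hba.symm
      (by rintro rfl; exact hab hby.symm) (by rintro rfl; exact hab hax) hxy
    rcases hu _ (hadj u') with h | h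
    · exact hxu (hf (h2.trans h.symm))
    · exact hyu (hf (h4.trans h.symm))
  obtain ⟨x, hxu, hax⟩ := hG.exists_second_neighbor hV hua.symm
  obtain ⟨y, hyu, hby⟩ := hG.exists_second_neighbor hV hub.symm
  obtain rfl := huniq x y hax hby hxu hyu
  obtain ⟨v, hv, y, hvy, hy⟩ := hG.1.exists_adj_notMem (s := {u', a, b, x}) (by simp)
    (by have := Finset.card_le_four (a := u') (b := a) (c := b) (d := x); omega)
  simp only [Finset.mem_insert, Finset.mem_singleton, not_or] at hv hy
  have ha : ∀ z, G.Adj a z → z = u' ∨ z = x := fun z hz => by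
    by_contra! h
    exact h.2 (huniq z x hz hby h.1 hxu)
  have hb : ∀ z, G.Adj b z → z = u' ∨ z = x := fun z hz => by
    by_contra! h
    exact h.2 (huniq x z hax hz hxu h.1).symm
  have hxy : G.Adj x y := by
    rcases hv with rfl | rfl | rfl | rfl
    · have := hu y hvy
      tauto
    · have := ha y hvy
      tauto
    · have := hb y hvy
      tauto
    · exact hvy
  obtain ⟨f, hf, hadj, hfx, hfy⟩ := hG.exists_matching_map_of_adj hV hxy
  have h1 : f a = u' := (ha _ (hadj a)).resolve_right
    fun h => hy.2.1 (hf (hfy.trans h.symm))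
  have h2 : f b = u' := (hb _ (hadj b)).resolve_right
    fun h => hy.2.2.1 (hf (hfy.trans h.symm))
  exact hba (hf (h2.trans h1.symm))

lemma IsExtendable.adj_of_degree_three_of_adj [DecidableRel G.Adj] (hG : IsExtendable G 2)
    (hV : Fintype.card V = 10) {u a b c : V} (hu : ∀ x, G.Adj u x → x = a ∨ x = b ∨ x = c)
    (hua : G.Adj u a) (hub : G.Adj u b) (hac : a ≠ c) (hbc : b ≠ c) (hab : G.Adj a b) :
    (∀ x, G.Adj c x → x = u ∨ x = a ∨ x = b) ∧ G.Adj c a ∧ G.Adj c b := by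
  classical
  have hc : ∀ x, G.Adj c x → x = u ∨ x = a ∨ x = b := by
    intro d hcd
    by_contra! hd
    obtain ⟨f, hf, hadj, h1, h2, h3, h4⟩ :=
      hG.exists_matching_map hab hcd hac hd.2.1.symm hbc hd.2.2.symm
    rcases hu _ (hadj u) with h | h | h
    · exact hub.ne (hf (h.trans h2.symm))
    · exact hua.ne (hf (h.trans h1.symm))
    · exact hd.1 (hf (h4.trans h.symm))
  have hsub : G.neighborFinset c ⊆ {u, a, b} := by
    intro x hx
    rw [mem_neighborFinset] at hx
    simpa using hc x hx
  have heq := Finset.eq_of_subset_of_card_le hsub (by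
    rw [card_neighborFinset_eq_degree]
    exact Finset.card_le_three.trans (hG.three_le_degree hV c))
  refine ⟨hc, ?_, ?_⟩ <;> rw [← mem_neighborFinset, heq] <;> simp

lemma IsExtendable.not_adj_of_degree_eq_three [DecidableRel G.Adj] (hG : IsExtendable G 2)
    (hV : Fintype.card V = 10) {u a b : V} (hu3 : G.degree u = 3) (hua : G.Adj u a)
    (hub : G.Adj u b) : ¬ G.Adj a b := by
  classical
  intro hab
  have hsub : ({a, b} : Finset V) ⊆ G.neighborFinset u := by
    intro y hy
    simp only [Finset.mem_insert, Finset.mem_singleton] at hy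
    rw [mem_neighborFinset]
    rcases hy with rfl | rfl <;> assumption
  obtain ⟨c, hc, hcab⟩ := Finset.exists_mem_notMem_of_card_lt_card
    (s := {a, b}) (t := G.neighborFinset u) (by
      rw [card_neighborFinset_eq_degree, Finset.card_pair hab.ne]
      omega)
  simp only [Finset.mem_insert, Finset.mem_singleton, not_or, mem_neighborFinset] at hc hcab
  have hNu : ∀ x, G.Adj u x → x = a ∨ x = b ∨ x = c := by
    intro x hx
    have heq := Finset.eq_of_subset_of_card_le (s := {a, b, c}) (t := G.neighborFinset u) (by
      intro y hy
      simp only [Finset.mem_insert, Finset.mem_singleton] at hy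
      rw [mem_neighborFinset]
      rcases hy with rfl | rfl | rfl <;> assumption) (by
      rw [card_neighborFinset_eq_degree, Finset.card_eq_three.2
        ⟨a, b, c, hab.ne, Ne.symm hcab.1, Ne.symm hcab.2, rfl⟩]
      omega)
    rw [← mem_neighborFinset, ← heq] at hx
    simpa using hx
  obtain ⟨hNc, hca, hcb⟩ := hG.adj_of_degree_three_of_adj hV hNu hua hub
    (Ne.symm hcab.1) (Ne.symm hcab.2) hab
  obtain ⟨hNb, -, -⟩ := hG.adj_of_degree_three_of_adj hV (u := u) (a := a) (b := c) (c := b)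
    (fun x hx => by have := hNu x hx; tauto) hua hc hab.ne hcab.2 hca.symm
  obtain ⟨hNa, -, -⟩ := hG.adj_of_degree_three_of_adj hV (u := u) (a := b) (b := c) (c := a)
    (fun x hx => by have := hNu x hx; tauto) hub hc hab.ne.symm hcab.1 hcb.symm
  obtain ⟨v, hv, y, hvy, hy⟩ := hG.1.exists_adj_notMem (s := {u, a, b, c}) (by simp)
    (by have := Finset.card_le_four (a := u) (b := a) (c := b) (d := c); omega)
  simp only [Finset.mem_insert, Finset.mem_singleton, not_or] at hv hy
  rcases hv with rfl | rfl | rfl | rfl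
  · have := hNu y hvy
    tauto
  · have := hNa y hvy
    tauto
  · have := hNb y hvy
    tauto
  · have := hNc y hvy
    tauto

lemma IsExtendable.exists_adj_of_card_eq_five (hG : IsExtendable G 2) (hV : Fintype.card V = 10)
    (hbip : ¬ G.Colorable 2) {I : Finset V} (hI : I.card = 5) :
    ∃ x ∈ I, ∃ y ∈ I, G.Adj x y := by
  classical
  by_contra! hind
  refine hbip ⟨Coloring.mk (fun v => if v ∈ I then (0 : Fin 2) else 1) ?_⟩
  intro x y hxy
  by_cases hx : x ∈ I <;> by_cases hy : y ∈ I
  · exact absurd hxy (hind x hx y hy)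
  · simp [hx, hy]
  · simp [hx, hy]
  · exfalso
    obtain ⟨f, hf, hadj, hfx, hfy⟩ := hG.exists_matching_map_of_adj hV hxy
    have hle := Finset.card_le_card_of_injOn (s := I) (t := Iᶜ \ {x, y}) f (by
      intro v hv
      simp only [Finset.coe_sdiff, Finset.coe_compl, Set.mem_sdiff, Set.mem_compl_iff,
        Finset.mem_coe, Finset.mem_insert, Finset.mem_singleton, not_or]
      refine ⟨fun h => hind v hv _ h (hadj v), fun h => hy ?_, fun h => hx ?_⟩
      · rwa [← hf (h.trans hfy.symm)]
      · rwa [← hf (h.trans hfx.symm)]) hf.injOn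
    rw [Finset.card_sdiff_of_subset (by simp [Finset.insert_subset_iff, hx, hy]),
      Finset.card_compl, Finset.card_pair hxy.ne] at hle
    omega

lemma IsExtendable.eq_of_adj_of_card_eq_four (hG : IsExtendable G 2) (hV : Fintype.card V = 10)
    {I : Finset V} (hI : I.card = 4) (hind : ∀ x ∈ I, ∀ y ∈ I, ¬ G.Adj x y) {x y z w : V}
    (hx : x ∉ I) (hy : y ∉ I) (hz : z ∉ I) (hw : w ∉ I) (hxy : G.Adj x y) (hzw : G.Adj z w) :
    x = z ∨ x = w ∨ y = z ∨ y = w := by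
  classical
  by_contra! h
  obtain ⟨f, hf, hadj, hfx, hfy, hfz, hfw⟩ :=
    hG.exists_matching_map hxy hzw h.1 h.2.1 h.2.2.1 h.2.2.2
  have hle := Finset.card_le_card_of_injOn (s := I) (t := Iᶜ \ {x, y, z, w}) f (by
    intro v hv
    simp only [Finset.coe_sdiff, Finset.coe_compl, Set.mem_sdiff, Set.mem_compl_iff,
      Finset.mem_coe, Finset.mem_insert, Finset.mem_singleton, not_or]
    refine ⟨fun h => hind v hv _ h (hadj v), fun h => hy ?_, fun h => hx ?_, fun h => hw ?_,
      fun h => hz ?_⟩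
    · rwa [← hf (h.trans hfy.symm)]
    · rwa [← hf (h.trans hfx.symm)]
    · rwa [← hf (h.trans hfw.symm)]
    · rwa [← hf (h.trans hfz.symm)]) hf.injOn
  have h4 : ({x, y, z, w} : Finset V).card = 4 :=
    Finset.card_eq_four.2 ⟨x, y, z, w, hxy.ne, h.1, h.2.1, h.2.2.1, h.2.2.2, hzw.ne, rfl⟩
  rw [Finset.card_sdiff_of_subset (by simp [Finset.insert_subset_iff, hx, hy, hz, hw]),
    Finset.card_compl, h4] at hle
  omega

lemma IsExtendable.exists_triangle_of_card_eq_four (hG : IsExtendable G 2)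
    (hV : Fintype.card V = 10) (hbip : ¬ G.Colorable 2) {I : Finset V} (hI : I.card = 4)
    (hind : ∀ x ∈ I, ∀ y ∈ I, ¬ G.Adj x y) :
    ∃ x y z, x ∉ I ∧ y ∉ I ∧ z ∉ I ∧ G.Adj x y ∧ G.Adj y z ∧ G.Adj x z := by
  classical
  have hIc : Iᶜ.card = 6 := by
    rw [Finset.card_compl]
    omega
  have herase : ∀ x, x ∉ I → ∃ y z, y ∉ I ∧ z ∉ I ∧ y ≠ x ∧ z ≠ x ∧ G.Adj y z := by
    intro x hx
    obtain ⟨y, hy, z, hz, hyz⟩ := hG.exists_adj_of_card_eq_five hV hbip (I := Iᶜ.erase x) (by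
      rw [Finset.card_erase_of_mem (by simpa using hx)]
      omega)
    simp only [Finset.mem_erase, Finset.mem_compl] at hy hz
    exact ⟨y, z, hy.2, hz.2, hy.1, hz.1, hyz⟩
  obtain ⟨x₀, hx₀⟩ := Finset.card_pos.1 (by omega : 0 < Iᶜ.card)
  obtain ⟨x, y, hx, hy, -, -, hxy⟩ := herase x₀ (by simpa using hx₀)
  have hmeet : ∀ x y, x ∉ I → y ∉ I → G.Adj x y → ∃ z, z ∉ I ∧ z ≠ x ∧ G.Adj y z := by
    intro x y hx hy hxy
    obtain ⟨p, q, hp, hq, hpx, hqx, hpq⟩ := herase x hx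
    rcases hG.eq_of_adj_of_card_eq_four hV hI hind hx hy hp hq hxy hpq with h | h | h | h
    · exact absurd h.symm hpx
    · exact absurd h.symm hqx
    · exact ⟨q, hq, hqx, h ▸ hpq⟩
    · exact ⟨p, hp, hpx, h ▸ hpq.symm⟩
  obtain ⟨z, hz, hzx, hyz⟩ := hmeet x y hx hy hxy
  obtain ⟨z', hz', hzy', hxz'⟩ := hmeet y x hy hx hxy.symm
  rcases hG.eq_of_adj_of_card_eq_four hV hI hind hx hz' hy hz hxz' hyz with h | h | h | h
  · exact absurd h hxy.ne
  · exact absurd h.symm hzx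
  · exact absurd h hzy'
  · exact ⟨x, y, z, hx, hy, hz, hxy, hyz, h ▸ hxz'⟩

lemma IsExtendable.exists_adj_of_card_eq_four [DecidableRel G.Adj] (hG : IsExtendable G 2)
    (hV : Fintype.card V = 10) (hbip : ¬ G.Colorable 2) {I : Finset V} (hI : I.card = 4) :
    ∃ x ∈ I, ∃ y ∈ I, G.Adj x y := by
  classical
  by_contra! hind
  have key : ∀ I : Finset V, I.card = 4 → (∀ x ∈ I, ∀ y ∈ I, ¬ G.Adj x y) →
      ∃ x y z, x ∉ I ∧ y ∉ I ∧ z ∉ I ∧ G.Adj x y ∧ G.Adj y z ∧ G.Adj x z ∧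
        ∀ p q, p ∉ I → q ∉ I → G.Adj p q → p ∈ ({x, y, z} : Finset V) := by
    intro I hI hind
    obtain ⟨x, y, z, hx, hy, hz, hxy, hyz, hxz⟩ :=
      hG.exists_triangle_of_card_eq_four hV hbip hI hind
    refine ⟨x, y, z, hx, hy, hz, hxy, hyz, hxz, fun p q hp hq hpq => ?_⟩
    have h1 := hG.eq_of_adj_of_card_eq_four hV hI hind hx hy hp hq hxy hpq
    have h2 := hG.eq_of_adj_of_card_eq_four hV hI hind hy hz hp hq hyz hpq
    have h3 := hG.eq_of_adj_of_card_eq_four hV hI hind hx hz hp hq hxz hpq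
    have := hxy.ne
    have := hyz.ne
    have := hxz.ne
    grind
  obtain ⟨x, y, z, hx, hy, hz, hxy, hyz, hxz, htri⟩ := key I hI hind
  have hxyz : ({x, y, z} : Finset V).card = 3 :=
    Finset.card_eq_three.2 ⟨x, y, z, hxy.ne, hxz.ne, hyz.ne, rfl⟩
  have hJ : (insert x (Iᶜ \ {x, y, z})).card = 4 := by
    rw [Finset.card_insert_of_notMem (by simp),
      Finset.card_sdiff_of_subset (by simp [Finset.insert_subset_iff, hx, hy, hz]),
      Finset.card_compl, hxyz]
    omega
  obtain ⟨x', y', z', -, -, -, -, -, -, htri'⟩ := key _ hJ (by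
    intro p hp q hq hpq
    have h1 := htri p q
    have h2 := htri q p
    have h3 := hpq.ne
    have h4 := hpq.symm
    simp only [Finset.mem_insert, Finset.mem_sdiff, Finset.mem_compl, Finset.mem_singleton]
      at hp hq h1 h2
    rcases hp with rfl | hp <;> rcases hq with rfl | hq <;> tauto)
  have hsub : G.neighborFinset y ⊆ insert x (({x', y', z'} : Finset V).erase y) := by
    intro t ht
    rw [mem_neighborFinset] at ht
    have h1 := htri t y
    have h2 := htri' t y
    have := ht.ne
    have := ht.symm
    have := hxy.ne
    clear key htri htri' hind
    simp only [Finset.mem_insert, Finset.mem_sdiff, Finset.mem_compl, Finset.mem_singleton,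
      Finset.mem_erase] at h1 h2 ⊢
    by_cases htx : t = x
    · exact Or.inl htx
    · have := Ne.symm hxy.ne
      have := Ne.symm ht.ne
      tauto
  have hcard := Finset.card_le_card hsub
  rw [card_neighborFinset_eq_degree] at hcard
  have h1 := Finset.card_insert_le x (({x', y', z'} : Finset V).erase y)
  have hy' : y ∈ ({x', y', z'} : Finset V) := by
    have h1 := htri' y z
    have := Ne.symm hxy.ne
    have := Ne.symm hxz.ne
    clear key htri htri' hind
    simp only [Finset.mem_insert, Finset.mem_sdiff, Finset.mem_compl, Finset.mem_singleton]
      at h1 ⊢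
    tauto
  rw [Finset.card_erase_of_mem hy'] at h1
  have h2 : ({x', y', z'} : Finset V).card ≤ 3 := Finset.card_le_three
  have h3 := hG.three_le_degree hV y
  exact hG.not_adj_of_degree_eq_three hV (by omega) hxy.symm hyz hxz

end Extendable

section Counting

variable {V : Type*} [DecidableEq V]

lemma notMem_and_card_eq_of_card_insert {n : ℕ} {a : V} {s : Finset V} (hs : s.card ≤ n)
    (h : (insert a s).card = n + 1) : a ∉ s ∧ s.card = n := by
  have ha : a ∉ s := by
    intro ha
    rw [Finset.insert_eq_of_mem ha] at h
    omega
  rw [Finset.card_insert_of_notMem ha] at h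
  exact ⟨ha, by omega⟩

lemma sum_six {a b c d e f : V} (h : ({a, b, c, d, e, f} : Finset V).card = 6) (F : V → ℕ) :
    ∑ x ∈ ({a, b, c, d, e, f} : Finset V), F x = F a + F b + F c + F d + F e + F f := by
  obtain ⟨ha, h⟩ := notMem_and_card_eq_of_card_insert Finset.card_le_five h
  obtain ⟨hb, h⟩ := notMem_and_card_eq_of_card_insert Finset.card_le_four h
  obtain ⟨hc, h⟩ := notMem_and_card_eq_of_card_insert Finset.card_le_three h
  obtain ⟨hd, h⟩ := notMem_and_card_eq_of_card_insert Finset.card_le_two h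
  obtain ⟨he, h⟩ := notMem_and_card_eq_of_card_insert (Finset.card_singleton f).le h
  rw [Finset.sum_insert ha, Finset.sum_insert hb, Finset.sum_insert hc, Finset.sum_insert hd,
    Finset.sum_insert he, Finset.sum_singleton]
  ring

lemma add_add_le_sum {W : Finset V} (hW : W.card = 6) {g : V → ℕ} (hg : ∀ x ∈ W, 1 ≤ g x)
    {v x : V} (hv : v ∈ W) (hx : x ∈ W) (hxv : x ≠ v) : g v + g x + 4 ≤ ∑ y ∈ W, g y := by
  have hx' : x ∈ W.erase v := Finset.mem_erase.2 ⟨hxv, hx⟩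
  rw [← Finset.add_sum_erase W g hv, ← Finset.add_sum_erase _ g hx']
  have hcard : ((W.erase v).erase x).card = 4 := by
    rw [Finset.card_erase_of_mem hx', Finset.card_erase_of_mem hv, hW]
  have := Finset.card_nsmul_le_sum ((W.erase v).erase x) (fun y => g y) 1 (fun y hy =>
    hg y (Finset.mem_of_mem_erase (Finset.mem_of_mem_erase hy)))
  rw [hcard, smul_eq_mul] at this
  omega

end Counting

section Indicator

variable {V : Type*} (G : SimpleGraph V) [DecidableRel G.Adj]

/-- The entries of the adjacency matrix, as natural numbers. -/
def adjInd (x y : V) : ℕ := if G.Adj x y then 1 else 0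

variable {G}

lemma adjInd_comm (x y : V) : adjInd G x y = adjInd G y x := by
  simp [adjInd, G.adj_comm]

lemma adjInd_self (x : V) : adjInd G x x = 0 := by
  simp [adjInd]

lemma adjInd_le_one (x y : V) : adjInd G x y ≤ 1 := by
  unfold adjInd
  split <;> omega

lemma adjInd_eq_one {x y : V} (h : G.Adj x y) : adjInd G x y = 1 := by
  simp [adjInd, h]

lemma adjInd_eq_zero {x y : V} (h : ¬ G.Adj x y) : adjInd G x y = 0 := by
  simp [adjInd, h]

lemma degree_eq_sum_adjInd [Fintype V] (v : V) : G.degree v = ∑ x, adjInd G v x := by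
  rw [← card_neighborFinset_eq_degree, neighborFinset_eq_filter, Finset.card_filter]
  rfl

lemma sum_adjInd_eq_card (W : Finset V) (v : V) :
    ∑ x ∈ W, adjInd G v x = (W.filter (G.Adj v)).card := by
  rw [Finset.card_filter]
  rfl

end Indicator

section SixVertices

variable {V : Type*} {G : SimpleGraph V} {W : Finset V}

/-- Among any three vertices of `W` some two are adjacent. -/
def TwoIndependent (G : SimpleGraph V) (W : Finset V) : Prop :=
  ∀ x ∈ W, ∀ y ∈ W, ∀ z ∈ W, x ≠ y → x ≠ z → y ≠ z → G.Adj x y ∨ G.Adj x z ∨ G.Adj y z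

lemma TwoIndependent.adj_of_not_adj (hα : TwoIndependent G W) {w x y : V} (hw : w ∈ W)
    (hx : x ∈ W) (hy : y ∈ W) (hxw : x ≠ w) (hyw : y ≠ w) (hxy : x ≠ y) (hwx : ¬ G.Adj w x)
    (hwy : ¬ G.Adj w y) : G.Adj x y := by
  rcases hα w hw x hx y hy hxw.symm hyw.symm hxy with h | h | h
  · exact absurd h hwx
  · exact absurd h hwy
  · exact h

variable [DecidableEq V] [DecidableRel G.Adj]

lemma card_nonneighbors (hW : W.card = 6) {w : V} (hw : w ∈ W) :
    ((W.erase w).filter (fun x => ¬ G.Adj w x)).card + ∑ x ∈ W, adjInd G w x = 5 := by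
  rw [sum_adjInd_eq_card]
  have h : W.filter (G.Adj w) = (W.erase w).filter (G.Adj w) := by
    ext x
    simp only [Finset.mem_filter, Finset.mem_erase]
    exact ⟨fun h => ⟨⟨h.2.ne', h.1⟩, h.2⟩, fun h => ⟨h.1.2, h.2⟩⟩
  rw [h, add_comm, Finset.card_filter_add_card_filter_not, Finset.card_erase_of_mem hw, hW]

lemma TwoIndependent.twenty_le_sum (hα : TwoIndependent G W) (hW : W.card = 6) {w : V}
    (hw : w ∈ W) (h0 : ∑ x ∈ W, adjInd G w x = 0) :
    20 ≤ ∑ x ∈ W, ∑ y ∈ W, adjInd G x y := by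
  have hna : ∀ x ∈ W, ¬ G.Adj w x := fun x hx h => by
    rw [Finset.sum_eq_zero_iff] at h0
    have := h0 x hx
    rw [adjInd_eq_one h] at this
    omega
  have h4 : ∀ x ∈ W.erase w, 4 ≤ ∑ y ∈ W, adjInd G x y := by
    intro x hx
    rw [sum_adjInd_eq_card]
    have hcard : ((W.erase w).erase x).card = 4 := by
      rw [Finset.card_erase_of_mem hx, Finset.card_erase_of_mem hw, hW]
    rw [← hcard]
    refine Finset.card_le_card fun y hy => ?_
    simp only [Finset.mem_erase] at hx hy
    exact Finset.mem_filter.2 ⟨hy.2.2, hα.adj_of_not_adj hw hx.2 hy.2.2 hx.1 hy.2.1 hy.1.symm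
      (hna x hx.2) (hna y hy.2.2)⟩
  have := Finset.card_nsmul_le_sum (W.erase w) _ 4 h4
  rw [Finset.card_erase_of_mem hw, hW, smul_eq_mul] at this
  rw [← Finset.add_sum_erase W _ hw]
  omega

lemma TwoIndependent.exists_pendant_edge (hα : TwoIndependent G W) (hW : W.card = 6) {w : V}
    (hw : w ∈ W) (h1 : ∑ x ∈ W, adjInd G w x = 1)
    (hD : ∑ x ∈ W, ∑ y ∈ W, adjInd G x y ≤ 14) :
    ∃ w' ∈ W, G.Adj w w' ∧ ∑ x ∈ W, adjInd G w' x = 1 := by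
  have hK := card_nonneighbors (G := G) hW hw
  have hY := h1
  rw [sum_adjInd_eq_card, Finset.card_eq_one] at hY
  rw [h1] at hK
  obtain ⟨w', hY⟩ := hY
  obtain ⟨k₁, k₂, k₃, k₄, h12, h13, h14, h23, h24, h34, hK⟩ := Finset.card_eq_four.1
    (by omega : ((W.erase w).filter (fun x => ¬ G.Adj w x)).card = 4)
  simp only [Finset.ext_iff, Finset.mem_filter, Finset.mem_erase, Finset.mem_insert,
    Finset.mem_singleton] at hY hK
  obtain ⟨hw', hww'⟩ := (hY w').2 rfl
  have hk₁ := (hK k₁).2 (by simp)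
  have hk₂ := (hK k₂).2 (by simp)
  have hk₃ := (hK k₃).2 (by simp)
  have hk₄ := (hK k₄).2 (by simp)
  have hWeq : W = {w, w', k₁, k₂, k₃, k₄} := by
    ext x
    have := hY x
    have := hK x
    simp only [Finset.mem_insert, Finset.mem_singleton]
    grind
  refine ⟨w', hw', hww', ?_⟩
  have hadj : ∀ x y, (x ≠ w ∧ x ∈ W) ∧ ¬ G.Adj w x → (y ≠ w ∧ y ∈ W) ∧ ¬ G.Adj w y → x ≠ y →
      adjInd G x y = 1 ∧ adjInd G y x = 1 := by
    intro x y hx hy hxy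
    have := hα.adj_of_not_adj hw hx.1.2 hy.1.2 hx.1.1 hy.1.1 hxy hx.2 hy.2
    exact ⟨adjInd_eq_one this, adjInd_eq_one this.symm⟩
  have e12 := hadj _ _ hk₁ hk₂ h12
  have e13 := hadj _ _ hk₁ hk₃ h13
  have e14 := hadj _ _ hk₁ hk₄ h14
  have e23 := hadj _ _ hk₂ hk₃ h23
  have e24 := hadj _ _ hk₂ hk₄ h24
  have e34 := hadj _ _ hk₃ hk₄ h34
  have eww := adjInd_eq_one hww'
  have eww' := adjInd_eq_one hww'.symm
  have e1 := adjInd_comm (G := G) w' k₁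
  have e2 := adjInd_comm (G := G) w' k₂
  have e3 := adjInd_comm (G := G) w' k₃
  have e4 := adjInd_comm (G := G) w' k₄
  have e0 := adjInd_self (G := G) w'
  clear hK hY hk₁ hk₂ hk₃ hk₄ hadj hα h1 hw hw'
  subst hWeq
  simp only [sum_six hW] at hD ⊢
  omega

lemma TwoIndependent.sixteen_le_sum (hα : TwoIndependent G W) (hW : W.card = 6) {w : V}
    (hw : w ∈ W) (h2 : ∑ x ∈ W, adjInd G w x = 2)
    (hind : ∀ x y, G.Adj w x → G.Adj w y → ¬ G.Adj x y) :
    16 ≤ ∑ x ∈ W, ∑ y ∈ W, adjInd G x y := by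
  have hK := card_nonneighbors (G := G) hW hw
  have hY := h2
  rw [sum_adjInd_eq_card, Finset.card_eq_two] at hY
  rw [h2] at hK
  obtain ⟨y, z, hyz, hY⟩ := hY
  obtain ⟨k₁, k₂, k₃, h12, h13, h23, hK⟩ := Finset.card_eq_three.1
    (by omega : ((W.erase w).filter (fun x => ¬ G.Adj w x)).card = 3)
  simp only [Finset.ext_iff, Finset.mem_filter, Finset.mem_erase, Finset.mem_insert,
    Finset.mem_singleton] at hY hK
  obtain ⟨hy, hwy⟩ := (hY y).2 (by simp)
  obtain ⟨hz, hwz⟩ := (hY z).2 (by simp)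
  have hk₁ := (hK k₁).2 (by simp)
  have hk₂ := (hK k₂).2 (by simp)
  have hk₃ := (hK k₃).2 (by simp)
  have hWeq : W = {w, y, z, k₁, k₂, k₃} := by
    ext x
    have := hY x
    have := hK x
    simp only [Finset.mem_insert, Finset.mem_singleton]
    grind
  have hadj : ∀ x y, (x ≠ w ∧ x ∈ W) ∧ ¬ G.Adj w x → (y ≠ w ∧ y ∈ W) ∧ ¬ G.Adj w y → x ≠ y →
      adjInd G x y = 1 ∧ adjInd G y x = 1 := by
    intro x y hx hy hxy
    have := hα.adj_of_not_adj hw hx.1.2 hy.1.2 hx.1.1 hy.1.1 hxy hx.2 hy.2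
    exact ⟨adjInd_eq_one this, adjInd_eq_one this.symm⟩
  have e12 := hadj _ _ hk₁ hk₂ h12
  have e13 := hadj _ _ hk₁ hk₃ h13
  have e23 := hadj _ _ hk₂ hk₃ h23
  have hyzk : ∀ k, (k ≠ w ∧ k ∈ W) ∧ ¬ G.Adj w k → 1 ≤ adjInd G y k + adjInd G z k := by
    intro k hk
    rcases hα y hy z hz k hk.1.2 hyz (by rintro rfl; exact hk.2 hwy)
      (by rintro rfl; exact hk.2 hwz) with h | h | h
    · exact absurd h (hind y z hwy hwz)
    · rw [adjInd_eq_one h]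
      omega
    · rw [adjInd_eq_one h]
      omega
  have c1 := hyzk _ hk₁
  have c2 := hyzk _ hk₂
  have c3 := hyzk _ hk₃
  have ewy := adjInd_eq_one hwy
  have ewz := adjInd_eq_one hwz
  have eyw := adjInd_eq_one hwy.symm
  have ezw := adjInd_eq_one hwz.symm
  have ey1 := adjInd_comm (G := G) y k₁
  have ey2 := adjInd_comm (G := G) y k₂
  have ey3 := adjInd_comm (G := G) y k₃
  have ez1 := adjInd_comm (G := G) z k₁
  have ez2 := adjInd_comm (G := G) z k₂
  have ez3 := adjInd_comm (G := G) z k₃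
  clear hK hY hk₁ hk₂ hk₃ hadj hα h2 hw hy hz hyzk
  subst hWeq
  simp only [sum_six hW]
  omega

lemma TwoIndependent.sixteen_lt_sum {v p q t₁ t₂ t₃ : V}
    (hα : TwoIndependent G {v, p, q, t₁, t₂, t₃})
    (hW : ({v, p, q, t₁, t₂, t₃} : Finset V).card = 6)
    (h12 : G.Adj t₁ t₂) (h13 : G.Adj t₁ t₃) (h23 : G.Adj t₂ t₃)
    (hvp : ¬ G.Adj v p) (hvq : ¬ G.Adj v q)
    (hv : 1 ≤ ∑ x ∈ ({v, p, q, t₁, t₂, t₃} : Finset V), adjInd G v x)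
    (hp : 2 ≤ ∑ x ∈ ({v, p, q, t₁, t₂, t₃} : Finset V), adjInd G p x)
    (hq : 2 ≤ ∑ x ∈ ({v, p, q, t₁, t₂, t₃} : Finset V), adjInd G q x)
    (hind : ∑ x ∈ ({v, p, q, t₁, t₂, t₃} : Finset V), adjInd G p x = 2 →
      ∀ x y, G.Adj p x → G.Adj p y → ¬ G.Adj x y) :
    16 < ∑ x ∈ ({v, p, q, t₁, t₂, t₃} : Finset V),
      ∑ y ∈ ({v, p, q, t₁, t₂, t₃} : Finset V), adjInd G x y := by
  have hcard := hW
  obtain ⟨hnv, hW⟩ := notMem_and_card_eq_of_card_insert Finset.card_le_five hW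
  obtain ⟨hnp, hW⟩ := notMem_and_card_eq_of_card_insert Finset.card_le_four hW
  obtain ⟨hnq, hW⟩ := notMem_and_card_eq_of_card_insert Finset.card_le_three hW
  simp only [Finset.mem_insert, Finset.mem_singleton, not_or] at hnv hnp hnq
  have hpq : G.Adj p q := hα.adj_of_not_adj (w := v) (by simp) (by simp) (by simp)
    (Ne.symm hnv.1) (Ne.symm hnv.2.1) hnp.1 hvp hvq
  have key : ∀ t ∈ ({v, p, q, t₁, t₂, t₃} : Finset V), v ≠ t → p ≠ t → q ≠ t →
      1 ≤ adjInd G v t + adjInd G p t ∧ 1 ≤ adjInd G v t + adjInd G q t ∧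
      (∑ x ∈ ({v, p, q, t₁, t₂, t₃} : Finset V), adjInd G p x = 2 →
        adjInd G p t + adjInd G q t ≤ 1) := by
    intro t ht hvt hpt hqt
    refine ⟨?_, ?_, fun h2 => ?_⟩
    · rcases hα v (by simp) p (by simp) t ht hnv.1 hvt hpt with h | h | h
      · exact absurd h hvp
      · rw [adjInd_eq_one h]
        omega
      · rw [adjInd_eq_one h]
        omega
    · rcases hα v (by simp) q (by simp) t ht hnv.2.1 hvt hqt with h | h | h
      · exact absurd h hvq
      · rw [adjInd_eq_one h]
        omega
      · rw [adjInd_eq_one h]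
        omega
    · by_cases hpt : G.Adj p t
      · rw [adjInd_eq_zero (hind h2 q t hpq hpt)]
        have := adjInd_le_one (G := G) p t
        omega
      · rw [adjInd_eq_zero hpt]
        have := adjInd_le_one (G := G) q t
        omega
  have k1 := key t₁ (by simp) hnv.2.2.1 hnp.2.1 hnq.1
  have k2 := key t₂ (by simp) hnv.2.2.2.1 hnp.2.2.1 hnq.2.1
  have k3 := key t₃ (by simp) hnv.2.2.2.2 hnp.2.2.2 hnq.2.2
  clear key hα hind hnv hnp hnq
  simp only [sum_six hcard, adjInd_self, adjInd_eq_one hpq, adjInd_eq_one hpq.symm,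
    adjInd_eq_one h12, adjInd_eq_one h12.symm, adjInd_eq_one h13, adjInd_eq_one h13.symm,
    adjInd_eq_one h23, adjInd_eq_one h23.symm, adjInd_eq_zero hvp, adjInd_eq_zero hvq,
    adjInd_eq_zero (show ¬ G.Adj p v from fun h => hvp h.symm), adjInd_comm t₁ v, adjInd_comm t₂ v, adjInd_comm t₃ v,
    adjInd_comm t₁ p, adjInd_comm t₂ p, adjInd_comm t₃ p,
    adjInd_comm t₁ q, adjInd_comm t₂ q, adjInd_comm t₃ q, adjInd_comm q v] at *
  have := adjInd_le_one (G := G) v t₁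
  have := adjInd_le_one (G := G) v t₂
  have := adjInd_le_one (G := G) v t₃
  omega

end SixVertices

section LowerBound

variable {V : Type*} {G : SimpleGraph V}

/-- The vertex `u` has exactly the three neighbors `a`, `b`, `c`, and `W` consists of the vertices
other than `u` that are not adjacent to `u`. -/
structure NeighborSplit (G : SimpleGraph V) (u a b c : V) (W : Finset V) : Prop where
  ne_ab : a ≠ b
  ne_ac : a ≠ c
  ne_bc : b ≠ c
  adj_iff : ∀ x, G.Adj u x ↔ x = a ∨ x = b ∨ x = c
  mem_iff : ∀ x, x ∈ W ↔ x ≠ u ∧ ¬ G.Adj u x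

namespace NeighborSplit

variable {u a b c : V} {W : Finset V}

lemma swap (h : NeighborSplit G u a b c W) : NeighborSplit G u b a c W where
  ne_ab := h.ne_ab.symm
  ne_ac := h.ne_bc
  ne_bc := h.ne_ac
  adj_iff x := by
    rw [h.adj_iff]
    tauto
  mem_iff := h.mem_iff

lemma rotate (h : NeighborSplit G u a b c W) : NeighborSplit G u b c a W where
  ne_ab := h.ne_bc
  ne_ac := h.ne_ab.symm
  ne_bc := h.ne_ac.symm
  adj_iff x := by
    rw [h.adj_iff]
    tauto
  mem_iff := h.mem_iff

lemma adj (h : NeighborSplit G u a b c W) : G.Adj u a := (h.adj_iff a).2 (Or.inl rfl)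

lemma notMem (h : NeighborSplit G u a b c W) : a ∉ W := fun ha => ((h.mem_iff a).1 ha).2 h.adj

lemma not_adj_of_mem (h : NeighborSplit G u a b c W) {w : V} (hw : w ∈ W) : ¬ G.Adj u w :=
  ((h.mem_iff w).1 hw).2

lemma ne_of_mem (h : NeighborSplit G u a b c W) {w : V} (hw : w ∈ W) : a ≠ w := by
  rintro rfl
  exact h.notMem hw

end NeighborSplit

variable [DecidableRel G.Adj]

/-- The number of neighbors of `w` among `a`, `b`, `c`. -/
def linkCount (G : SimpleGraph V) [DecidableRel G.Adj] (a b c w : V) : ℕ :=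
  adjInd G w a + adjInd G w b + adjInd G w c

lemma sum_linkCount (a b c : V) (W : Finset V) : ∑ x ∈ W, linkCount G a b c x =
    ∑ x ∈ W, adjInd G a x + ∑ x ∈ W, adjInd G b x + ∑ x ∈ W, adjInd G c x := by
  simp only [linkCount, Finset.sum_add_distrib, adjInd_comm (G := G) _ a,
    adjInd_comm (G := G) _ b, adjInd_comm (G := G) _ c]

lemma linkCount_swap (a b c w : V) : linkCount G b a c w = linkCount G a b c w := by
  rw [linkCount, linkCount, add_comm (adjInd G w b)]

variable [Fintype V]

/-- The local conditions on a 2-extendable non-bipartite graph with ten vertices that force it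
to have many edges. -/
structure LocallyRestricted (G : SimpleGraph V) [DecidableRel G.Adj] : Prop where
  card_eq : Fintype.card V = 10
  three_le_degree : ∀ u, 3 ≤ G.degree u
  not_adj : ∀ u a b, G.degree u = 3 → G.Adj u a → G.Adj u b → ¬ G.Adj a b
  exists_adj : ∀ x y z w, x ≠ y → x ≠ z → x ≠ w → y ≠ z → y ≠ w → z ≠ w →
    G.Adj x y ∨ G.Adj x z ∨ G.Adj x w ∨ G.Adj y z ∨ G.Adj y w ∨ G.Adj z w

lemma IsExtendable.locallyRestricted (hG : IsExtendable G 2) (hV : Fintype.card V = 10)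
    (hbip : ¬ G.Colorable 2) : LocallyRestricted G where
  card_eq := hV
  three_le_degree := hG.three_le_degree hV
  not_adj _ _ _ := hG.not_adj_of_degree_eq_three hV
  exists_adj x y z w hxy hxz hxw hyz hyw hzw := by
    classical
    obtain ⟨p, hp, q, hq, hpq⟩ := hG.exists_adj_of_card_eq_four hV hbip
      (Finset.card_eq_four.2 ⟨x, y, z, w, hxy, hxz, hxw, hyz, hyw, hzw, rfl⟩)
    simp only [Finset.mem_insert, Finset.mem_singleton] at hp hq
    have := hpq.symm
    rcases hp with rfl | rfl | rfl | rfl <;> rcases hq with rfl | rfl | rfl | rfl <;>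
      first | exact absurd rfl hpq.ne | tauto

namespace NeighborSplit

variable {u a b c : V} {W : Finset V}

lemma sum_eq (h : NeighborSplit G u a b c W) (f : V → ℕ) :
    ∑ x, f x = f u + f a + f b + f c + ∑ x ∈ W, f x := by
  classical
  have huniv : Finset.univ = insert u (insert a (insert b (insert c W))) := by
    ext x
    have h1 := h.mem_iff x
    have h2 := h.adj_iff x
    simp only [Finset.mem_univ, Finset.mem_insert, true_iff]
    tauto
  have hu : u ∉ W := fun hu => ((h.mem_iff u).1 hu).1 rfl
  have ha := h.adj.ne
  have hb := h.rotate.adj.ne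
  have hc := h.rotate.rotate.adj.ne
  rw [huniv, Finset.sum_insert (by simp [ha, hb, hc, hu]),
    Finset.sum_insert (by simp [h.ne_ab, h.ne_ac, h.notMem]),
    Finset.sum_insert (by simp [h.ne_bc, h.rotate.notMem]),
    Finset.sum_insert h.rotate.rotate.notMem]
  ring

lemma card_eq (h : NeighborSplit G u a b c W) (hG : LocallyRestricted G) : W.card = 6 := by
  have := h.sum_eq (fun _ => 1)
  simp only [Finset.sum_const, Finset.card_univ, hG.card_eq, smul_eq_mul] at this
  omega

lemma degree_eq_three (h : NeighborSplit G u a b c W) : G.degree u = 3 := by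
  rw [degree_eq_sum_adjInd, h.sum_eq, adjInd_self, adjInd_eq_one h.adj,
    adjInd_eq_one h.rotate.adj, adjInd_eq_one h.rotate.rotate.adj,
    Finset.sum_eq_zero fun w hw => adjInd_eq_zero (h.not_adj_of_mem hw), add_zero, zero_add]

lemma not_adj (h : NeighborSplit G u a b c W) (hG : LocallyRestricted G) : ¬ G.Adj a b :=
  hG.not_adj u a b h.degree_eq_three h.adj h.rotate.adj

lemma degree_eq (h : NeighborSplit G u a b c W) (hG : LocallyRestricted G) :
    G.degree a = 1 + ∑ x ∈ W, adjInd G a x := by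
  rw [degree_eq_sum_adjInd, h.sum_eq, adjInd_self, adjInd_eq_one h.adj.symm,
    adjInd_eq_zero (h.not_adj hG),
    adjInd_eq_zero fun hac => h.rotate.rotate.not_adj hG hac.symm]

lemma degree_eq_of_mem (h : NeighborSplit G u a b c W) {w : V} (hw : w ∈ W) :
    G.degree w = linkCount G a b c w + ∑ x ∈ W, adjInd G w x := by
  rw [degree_eq_sum_adjInd, h.sum_eq,
    adjInd_eq_zero (fun hwu => h.not_adj_of_mem hw hwu.symm), linkCount]
  ring

lemma one_le_linkCount (h : NeighborSplit G u a b c W) (hG : LocallyRestricted G) {w : V}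
    (hw : w ∈ W) : 1 ≤ linkCount G a b c w := by
  rw [linkCount]
  rcases hG.exists_adj a b c w h.ne_ab h.ne_ac (h.ne_of_mem hw) h.ne_bc (h.rotate.ne_of_mem hw)
    (h.rotate.rotate.ne_of_mem hw) with h' | h' | h' | h' | h' | h'
  · exact absurd h' (h.not_adj hG)
  · exact absurd h'.symm (h.rotate.rotate.not_adj hG)
  · rw [adjInd_eq_one h'.symm]
    omega
  · exact absurd h' (h.rotate.not_adj hG)
  · rw [adjInd_eq_one h'.symm]
    omega
  · rw [adjInd_eq_one h'.symm]
    omega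

lemma twoIndependent (h : NeighborSplit G u a b c W) (hG : LocallyRestricted G) :
    TwoIndependent G W := by
  intro x hx y hy z hz hxy hxz hyz
  have := hG.exists_adj u x y z ((h.mem_iff x).1 hx).1.symm ((h.mem_iff y).1 hy).1.symm
    ((h.mem_iff z).1 hz).1.symm hxy hxz hyz
  have := h.not_adj_of_mem hx
  have := h.not_adj_of_mem hy
  have := h.not_adj_of_mem hz
  tauto

lemma two_le_sum_adjInd (h : NeighborSplit G u a b c W) (hG : LocallyRestricted G) :
    2 ≤ ∑ x ∈ W, adjInd G a x := by
  have h1 := hG.three_le_degree a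
  rw [h.degree_eq hG] at h1
  omega

lemma exists_two_le_linkCount (h : NeighborSplit G u a b c W) (hG : LocallyRestricted G)
    (ha : ∑ x ∈ W, adjInd G a x = 2) :
    ∃ v ∈ W, ∃ p ∈ W, v ≠ p ∧ G.Adj a v ∧ G.Adj a p ∧ (∀ x ∈ W, G.Adj a x → x = v ∨ x = p) ∧
      ¬ G.Adj v p ∧ 2 ≤ linkCount G a b c v := by
  classical
  have hdeg := h.degree_eq hG
  rw [ha] at hdeg
  rw [sum_adjInd_eq_card, Finset.card_eq_two] at ha
  obtain ⟨v, p, hvp, hN⟩ := ha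
  simp only [Finset.ext_iff, Finset.mem_filter, Finset.mem_insert, Finset.mem_singleton] at hN
  obtain ⟨hv, hav⟩ := (hN v).2 (by simp)
  obtain ⟨hp, hap⟩ := (hN p).2 (by simp)
  have hnvp := hG.not_adj a v p hdeg hav hap
  have hall : ∀ x ∈ W, G.Adj a x → x = v ∨ x = p := fun x hx hax => (hN x).1 ⟨hx, hax⟩
  have hlink : 2 ≤ linkCount G a b c v ∨ 2 ≤ linkCount G a b c p := by
    simp only [linkCount, adjInd_eq_one hav.symm, adjInd_eq_one hap.symm]
    rcases hG.exists_adj b c v p h.ne_bc (h.rotate.ne_of_mem hv) (h.rotate.ne_of_mem hp)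
      (h.rotate.rotate.ne_of_mem hv) (h.rotate.rotate.ne_of_mem hp) hvp
      with h' | h' | h' | h' | h' | h'
    · exact absurd h' (h.rotate.not_adj hG)
    · rw [adjInd_eq_one h'.symm]
      omega
    · rw [adjInd_eq_one (x := p) h'.symm]
      omega
    · rw [adjInd_eq_one h'.symm]
      omega
    · rw [adjInd_eq_one (x := p) h'.symm]
      omega
    · exact absurd h' hnvp
  rcases hlink with hlink | hlink
  · exact ⟨v, hv, p, hp, hvp, hav, hap, hall, hnvp, hlink⟩
  · exact ⟨p, hp, v, hv, hvp.symm, hap, hav, fun x hx hax => (hall x hx hax).symm,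
      fun hpv => hnvp hpv.symm, hlink⟩

lemma adj_of_linkCount_eq_one (h : NeighborSplit G u a b c W) (hG : LocallyRestricted G)
    {x y : V} (hx : x ∈ W) (hy : y ∈ W) (hxy : x ≠ y) (hx1 : linkCount G a b c x = 1)
    (hy1 : linkCount G a b c y = 1) (hcx : G.Adj c x) (hcy : G.Adj c y) : G.Adj x y := by
  rw [linkCount, adjInd_eq_one hcx.symm] at hx1
  rw [linkCount, adjInd_eq_one hcy.symm] at hy1
  rcases hG.exists_adj a b x y h.ne_ab (h.ne_of_mem hx) (h.ne_of_mem hy)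
    (h.rotate.ne_of_mem hx) (h.rotate.ne_of_mem hy) hxy with h' | h' | h' | h' | h' | h'
  · exact absurd h' (h.not_adj hG)
  · rw [adjInd_eq_one h'.symm] at hx1
    omega
  · rw [adjInd_eq_one h'.symm] at hy1
    omega
  · rw [adjInd_eq_one h'.symm] at hx1
    omega
  · rw [adjInd_eq_one h'.symm] at hy1
    omega
  · exact h'

lemma sixteen_lt_sum (h : NeighborSplit G u a b c W) (hG : LocallyRestricted G)
    (ha : ∑ x ∈ W, adjInd G a x = 2) (hb : ∑ x ∈ W, adjInd G b x = 2)
    (hc : ∑ x ∈ W, adjInd G c x = 3) : 16 < ∑ x ∈ W, ∑ y ∈ W, adjInd G x y := by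
  classical
  have hW := h.card_eq hG
  have hE := sum_linkCount (G := G) a b c W
  rw [ha, hb, hc] at hE
  have hg : ∀ x ∈ W, 1 ≤ linkCount G a b c x := fun x hx => h.one_le_linkCount hG hx
  obtain ⟨v, hv, p, hp, hvp, hav, hap, -, hnvp, hgv⟩ := h.exists_two_le_linkCount hG ha
  obtain ⟨v', hv', q, hq, hvq, hbv, hbq, -, hnvq, hgv'⟩ := h.swap.exists_two_le_linkCount hG hb
  rw [linkCount_swap] at hgv'
  obtain rfl : v' = v := by
    by_contra hne
    have := add_add_le_sum hW hg hv hv' hne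
    omega
  have hg1 : ∀ x ∈ W, x ≠ v' → linkCount G a b c x = 1 := by
    intro x hx hne
    have := add_add_le_sum hW hg hv hx hne
    have := hg x hx
    omega
  have hgv2 : linkCount G a b c v' = 2 := by
    have := add_add_le_sum hW hg hv hp hvp.symm
    have := hg p hp
    omega
  have hgp := hg1 p hp hvp.symm
  have hgq := hg1 q hq hvq.symm
  have hcv : ¬ G.Adj c v' := fun h' => by
    rw [linkCount, adjInd_eq_one hav.symm, adjInd_eq_one hbv.symm, adjInd_eq_one h'.symm] at hgv2
    omega
  have hcp : ¬ G.Adj c p := fun h' => by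
    rw [linkCount, adjInd_eq_one hap.symm, adjInd_eq_one h'.symm] at hgp
    omega
  have hcq : ¬ G.Adj c q := fun h' => by
    rw [linkCount, adjInd_eq_one hbq.symm, adjInd_eq_one h'.symm] at hgq
    omega
  have hpq : p ≠ q := by
    rintro rfl
    rw [linkCount, adjInd_eq_one hap.symm, adjInd_eq_one hbq.symm] at hgp
    omega
  rw [sum_adjInd_eq_card, Finset.card_eq_three] at hc
  obtain ⟨t₁, t₂, t₃, h12, h13, h23, hN⟩ := hc
  simp only [Finset.ext_iff, Finset.mem_filter, Finset.mem_insert, Finset.mem_singleton] at hN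
  obtain ⟨ht₁, hct₁⟩ := (hN t₁).2 (by simp)
  obtain ⟨ht₂, hct₂⟩ := (hN t₂).2 (by simp)
  obtain ⟨ht₃, hct₃⟩ := (hN t₃).2 (by simp)
  have hne : ∀ {x y}, ¬ G.Adj c x → G.Adj c y → x ≠ y := by
    rintro x y hx hy rfl
    exact hx hy
  have hcard : ({v', p, q, t₁, t₂, t₃} : Finset V).card = 6 := by
    rw [Finset.card_insert_of_notMem (by simp [hvp, hvq, hne hcv hct₁, hne hcv hct₂, hne hcv hct₃]),
      Finset.card_insert_of_notMem (by simp [hpq, hne hcp hct₁, hne hcp hct₂, hne hcp hct₃]),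
      Finset.card_insert_of_notMem (by simp [hne hcq hct₁, hne hcq hct₂, hne hcq hct₃]),
      Finset.card_insert_of_notMem (by simp [h12, h13]),
      Finset.card_insert_of_notMem (by simp [h23]), Finset.card_singleton]
  obtain rfl : {v', p, q, t₁, t₂, t₃} = W := Finset.eq_of_subset_of_card_le
    (by simp [Finset.insert_subset_iff, hv, hp, hq, ht₁, ht₂, ht₃]) (by rw [hcard, hW])
  have hdeg := fun x => hG.three_le_degree x
  have hdv := h.degree_eq_of_mem hv
  have hdp := h.degree_eq_of_mem hp
  have hdq := h.degree_eq_of_mem hq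
  have hadj : ∀ x y, G.Adj c x → G.Adj c y → x ∈ ({v', p, q, t₁, t₂, t₃} : Finset V) →
      y ∈ ({v', p, q, t₁, t₂, t₃} : Finset V) → x ≠ y → G.Adj x y := by
    intro x y hcx hcy hx hy hxy
    exact h.adj_of_linkCount_eq_one hG hx hy hxy (hg1 x hx (hne hcv hcx).symm)
      (hg1 y hy (hne hcv hcy).symm) hcx hcy
  have := hdeg v'
  have := hdeg p
  have := hdeg q
  exact (h.twoIndependent hG).sixteen_lt_sum hcard (hadj _ _ hct₁ hct₂ ht₁ ht₂ h12)
    (hadj _ _ hct₁ hct₃ ht₁ ht₃ h13) (hadj _ _ hct₂ hct₃ ht₂ ht₃ h23) hnvp hnvq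
    (by omega) (by omega) (by omega) fun h2 x y => hG.not_adj p x y (by omega)

lemma fourteen_lt_sum (h : NeighborSplit G u a b c W) (hG : LocallyRestricted G) {w : V}
    (hw : w ∈ W) (hdeg : G.degree w = 3) : 14 < ∑ x ∈ W, ∑ y ∈ W, adjInd G x y := by
  classical
  by_contra! hD
  have hα := h.twoIndependent hG
  have hW := h.card_eq hG
  have hgw := h.one_le_linkCount hG hw
  have hdw := h.degree_eq_of_mem hw
  obtain h0 | h1 | h2 : ∑ x ∈ W, adjInd G w x = 0 ∨ ∑ x ∈ W, adjInd G w x = 1 ∨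
      ∑ x ∈ W, adjInd G w x = 2 := by omega
  · have := hα.twenty_le_sum hW hw h0
    omega
  · obtain ⟨w', hw', hww', h1'⟩ := hα.exists_pendant_edge hW hw h1 hD
    have hdw' := h.degree_eq_of_mem hw'
    have hle := hG.three_le_degree w'
    have hcommon : ∀ z, adjInd G w z + adjInd G w' z ≤ 1 := by
      intro z
      by_cases hwz : G.Adj w z
      · rw [adjInd_eq_zero (hG.not_adj w w' z hdeg hww' hwz)]
        exact adjInd_le_one w z
      · rw [adjInd_eq_zero hwz, zero_add]
        exact adjInd_le_one w' z
    have ha := hcommon a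
    have hb := hcommon b
    have hc := hcommon c
    rw [linkCount] at hdw hdw'
    omega
  · have := hα.sixteen_le_sum hW hw h2 fun x y => hG.not_adj w x y hdeg
    omega

lemma seven_le_sum_linkCount (h : NeighborSplit G u a b c W) (hG : LocallyRestricted G) :
    7 ≤ ∑ x ∈ W, linkCount G a b c x := by
  classical
  have hE := sum_linkCount (G := G) a b c W
  have ha := h.two_le_sum_adjInd hG
  have hb := h.rotate.two_le_sum_adjInd hG
  have hc := h.rotate.rotate.two_le_sum_adjInd hG
  by_cases ha2 : ∑ x ∈ W, adjInd G a x = 2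
  · obtain ⟨v, hv, p, hp, hvp, -, -, -, -, hgv⟩ := h.exists_two_le_linkCount hG ha2
    have := add_add_le_sum (h.card_eq hG) (fun x hx => h.one_le_linkCount hG hx) hv hp hvp.symm
    have := h.one_le_linkCount hG hp
    omega
  · omega

lemma thirty_six_lt_sum_degree (h : NeighborSplit G u a b c W) (hG : LocallyRestricted G) :
    36 < ∑ x, G.degree x := by
  by_contra! hle
  have hE := sum_linkCount (G := G) a b c W
  have h7 := h.seven_le_sum_linkCount hG
  have ha := h.two_le_sum_adjInd hG
  have hb := h.rotate.two_le_sum_adjInd hG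
  have hc := h.rotate.rotate.two_le_sum_adjInd hG
  have hsum : ∑ x ∈ W, G.degree x =
      ∑ x ∈ W, linkCount G a b c x + ∑ x ∈ W, ∑ y ∈ W, adjInd G x y := by
    rw [← Finset.sum_add_distrib]
    exact Finset.sum_congr rfl fun x hx => h.degree_eq_of_mem hx
  rw [h.sum_eq, h.degree_eq_three, h.degree_eq hG, h.rotate.degree_eq hG,
    h.rotate.rotate.degree_eq hG, hsum] at hle
  by_cases hE7 : ∑ x ∈ W, linkCount G a b c x = 7
  · obtain ⟨h1, h2, h3⟩ | ⟨h1, h2, h3⟩ | ⟨h1, h2, h3⟩ :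
        (∑ x ∈ W, adjInd G a x = 2 ∧ ∑ x ∈ W, adjInd G b x = 2 ∧ ∑ x ∈ W, adjInd G c x = 3) ∨
        (∑ x ∈ W, adjInd G b x = 2 ∧ ∑ x ∈ W, adjInd G c x = 2 ∧ ∑ x ∈ W, adjInd G a x = 3) ∨
        (∑ x ∈ W, adjInd G c x = 2 ∧ ∑ x ∈ W, adjInd G a x = 2 ∧ ∑ x ∈ W, adjInd G b x = 3) := by
      omega
    · have := h.sixteen_lt_sum hG h1 h2 h3
      omega
    · have := h.rotate.sixteen_lt_sum hG h1 h2 h3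
      omega
    · have := h.rotate.rotate.sixteen_lt_sum hG h1 h2 h3
      omega
  · obtain ⟨w, hw, hdeg⟩ : ∃ w ∈ W, G.degree w = 3 := by
      by_contra! hne
      have := Finset.card_nsmul_le_sum W (fun x => G.degree x) 4 fun x hx => by
        have := hne x hx
        have := hG.three_le_degree x
        omega
      rw [h.card_eq hG, smul_eq_mul] at this
      omega
    have := h.fourteen_lt_sum hG hw hdeg
    omega

end NeighborSplit

lemma LocallyRestricted.nineteen_le_card_edgeFinset (hG : LocallyRestricted G) :
    19 ≤ G.edgeFinset.card := by
  classical
  by_contra! hlt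
  have hsum := G.sum_degrees_eq_twice_card_edges
  obtain ⟨u, hu⟩ : ∃ u, G.degree u = 3 := by
    by_contra! hne
    have := Finset.card_nsmul_le_sum Finset.univ (fun x => G.degree x) 4 fun x _ => by
      have := hne x
      have := hG.three_le_degree x
      omega
    rw [Finset.card_univ, hG.card_eq, smul_eq_mul] at this
    omega
  rw [← card_neighborFinset_eq_degree, Finset.card_eq_three] at hu
  obtain ⟨a, b, c, hab, hac, hbc, hN⟩ := hu
  have h : NeighborSplit G u a b c (Finset.univ.filter fun x => x ≠ u ∧ ¬ G.Adj u x) :=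
    { ne_ab := hab
      ne_ac := hac
      ne_bc := hbc
      adj_iff := fun x => by
        rw [← mem_neighborFinset, hN]
        simp
      mem_iff := fun x => by simp }
  have := h.thirty_six_lt_sum_degree hG
  omega

end LowerBound

theorem eps_ten_two :
    (∀ (V : Type) [Fintype V] (G : SimpleGraph V), Fintype.card V = 10 →
      IsExtendable G 2 → ¬ G.Colorable 2 → 19 ≤ G.edgeSet.ncard) ∧
    (∃ G : SimpleGraph (Fin 10), IsExtendable G 2 ∧ ¬ G.Colorable 2 ∧
      G.edgeSet.ncard = 19) := by
  classical
  refine ⟨fun V _ G hV hG hbip => ?_, sparseGraph, sparseGraph_isExtendable,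
    sparseGraph_not_colorable, sparseGraph_ncard_edgeSet⟩
  rw [← coe_edgeFinset, Set.ncard_coe_finset]
  exact (hG.locallyRestricted hV hbip).nineteen_le_card_edgeFinset
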